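/- arXiv:quant-ph/0607134 — 2 statements merged into one kernel-verified Lean document; each statement's English description precedes it below -/
import Mathlib

section
/- Let H be a complex Hilbert space, S : ℝ → B(H) a strongly continuous one-parameter unitary group, and g_1,…,g_N ∈ H such that t ↦ ⟨g_m, S_t g_n⟩ is integrable on ℝ for all m, n. Then for every E ∈ ℝ, the N×N complex matrix M with entries M_{m,n} = ∫_ℝ e^{−itE} ⟨g_m, S_t g_n⟩ dt is Hermitian positive semidefinite, i.e., for all c_1,…,c_N ∈ ℂ one has Σ_{m,n} conj(c_m) c_n M_{m,n} ≥ 0. In particular, for a single vector g the number ∫_ℝ e^{−itE} ⟨g, S_t g⟩ dt = 2 Re γ_{g,g}(E) is a nonnegative real. -/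
open MeasureTheory
open scoped InnerProductSpace ComplexOrder

open Filter Topology

section

variable {H : Type*} [NormedAddCommGroup H] [InnerProductSpace ℂ H] [CompleteSpace H]

/-- The double integral is the squared norm of `∫₀¹ x`, hence nonnegative. -/
lemma integral_integral_inner_nonneg {x : ℝ → H} (hx : Continuous x) :
    0 ≤ ∫ u in (0 : ℝ)..1, ∫ v in (0 : ℝ)..1, ⟪x u, x v⟫_ℂ := by
  set y : H := ∫ u in (0 : ℝ)..1, x u with hy
  have hright : ∀ z : H, ∫ v in (0 : ℝ)..1, ⟪z, x v⟫_ℂ = ⟪z, y⟫_ℂ := fun z =>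
    (innerSL ℂ z).intervalIntegral_comp_comm (hx.intervalIntegrable 0 1)
  have hleft : ∫ u in (0 : ℝ)..1, ⟪x u, y⟫_ℂ = ⟪y, y⟫_ℂ := by
    rw [← inner_conj_symm y y, ← hright y]
    simp only [intervalIntegral.integral_of_le zero_le_one, ← integral_conj, inner_conj_symm]
  simp only [hright, hleft]
  rw [inner_self_eq_norm_sq_to_K]
  simp

/-- Stationary correlations have a nonnegative total integral. -/
lemma integral_nonneg_of_inner_eq_sub {x : ℝ → H} (hx : Continuous x) {F : ℝ → ℂ}
    (hF : Integrable F) (hxF : ∀ s t : ℝ, ⟪x s, x t⟫_ℂ = F (t - s)) :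
    0 ≤ ∫ t, F t := by
  have hnonneg : ∀ T : ℝ, 0 ≤ T →
      0 ≤ ∫ u in (0 : ℝ)..1, ∫ t in (-(T * u))..(T - T * u), F t := by
    intro T hT
    have h := integral_integral_inner_nonneg (x := fun u => x (T * u)) (by fun_prop)
    have h' : ∫ u in (0 : ℝ)..1, ∫ t in (-(T * u))..(T - T * u), F t =
        (T : ℂ) * ∫ u in (0 : ℝ)..1, ∫ v in (0 : ℝ)..1, ⟪x (T * u), x (T * v)⟫_ℂ := by
      rw [← intervalIntegral.integral_const_mul]
      refine intervalIntegral.integral_congr fun u _ => ?_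
      simp only [hxF]
      rw [← Complex.real_smul, intervalIntegral.smul_integral_comp_mul_sub]
      simp
    rw [h']
    exact mul_nonneg (by exact_mod_cast hT) h
  have hlim : Tendsto (fun T : ℝ => ∫ u in (0 : ℝ)..1, ∫ t in (-(T * u))..(T - T * u), F t)
      atTop (𝓝 (∫ _ in (0 : ℝ)..1, ∫ t, F t)) := by
    refine intervalIntegral.tendsto_integral_filter_of_dominated_convergence
      (fun _ => ∫ t, ‖F t‖) ?_ ?_ (by simp) ?_
    · refine Eventually.of_forall fun T => Continuous.aestronglyMeasurable ?_
      have hprim : Continuous fun b : ℝ => ∫ t in (0 : ℝ)..b, F t :=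
        intervalIntegral.continuous_primitive (fun a b => hF.intervalIntegrable) 0
      have heq : (fun u : ℝ => ∫ t in (-(T * u))..(T - T * u), F t) = fun u =>
          (∫ t in (0 : ℝ)..(T - T * u), F t) - ∫ t in (0 : ℝ)..(-(T * u)), F t := by
        funext u
        rw [intervalIntegral.integral_interval_sub_left hF.intervalIntegrable
          hF.intervalIntegrable]
      rw [heq]
      exact (hprim.comp (by fun_prop)).sub (hprim.comp (by fun_prop))
    · refine Eventually.of_forall fun T => Eventually.of_forall fun u _ => ?_
      refine intervalIntegral.norm_integral_le_integral_norm_uIoc.trans ?_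
      exact setIntegral_le_integral hF.norm (Eventually.of_forall fun t => norm_nonneg _)
    · have hne : ∀ᵐ u : ℝ, u ≠ 1 := by simp [ae_iff]
      filter_upwards [hne] with u hu1 hu
      rw [Set.uIoc_of_le zero_le_one] at hu
      have hu' : 0 < 1 - u := sub_pos.2 (lt_of_le_of_ne hu.2 hu1)
      refine intervalIntegral_tendsto_integral hF
        (tendsto_neg_atTop_atBot.comp (tendsto_id.atTop_mul_const hu.1)) ?_
      refine (tendsto_id.atTop_mul_const hu').congr fun T => ?_
      simp only [id]
      ring
  have h := ge_of_tendsto hlim ((eventually_ge_atTop 0).mono hnonneg)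
  simpa using h

end

/-- The spectral Gram matrix `M_{m,n} = ∫ e^{−itE} ⟨g_m, S_t g_n⟩ dt` of a family of
vectors, for a strongly continuous one-parameter unitary group `S`, is Hermitian
positive semidefinite: `conj(M_{m,n}) = M_{n,m}` and
`Σ_{m,n} conj(c_m) c_n M_{m,n} ≥ 0` for all complex `c`. -/
theorem spectral_gram_matrix_posSemidef
    {H : Type*} [NormedAddCommGroup H] [InnerProductSpace ℂ H] [CompleteSpace H]
    (S : ℝ → (H →L[ℂ] H))
    (hS0 : S 0 = 1)
    (hSadd : ∀ s t : ℝ, S (s + t) = S s * S t)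
    (hSunitary : ∀ t : ℝ, S t ∈ unitary (H →L[ℂ] H))
    (hScont : ∀ x : H, Continuous fun t : ℝ => S t x)
    (N : ℕ) (g : Fin N → H)
    (hint : ∀ m n : Fin N, Integrable fun t : ℝ => ⟪g m, S t (g n)⟫_ℂ)
    (E : ℝ) :
    (∀ m n : Fin N,
        (starRingEnd ℂ) (∫ t : ℝ, Complex.exp (-(Complex.I * t * E)) * ⟪g m, S t (g n)⟫_ℂ) =
          ∫ t : ℝ, Complex.exp (-(Complex.I * t * E)) * ⟪g n, S t (g m)⟫_ℂ) ∧
      ∀ c : Fin N → ℂ,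
        0 ≤ ∑ m, ∑ n, (starRingEnd ℂ) (c m) * c n *
              ∫ t : ℝ, Complex.exp (-(Complex.I * t * E)) * ⟪g m, S t (g n)⟫_ℂ := by
  have hshift : ∀ (s t : ℝ) (a b : H), ⟪S s a, S t b⟫_ℂ = ⟪a, S (t - s) b⟫_ℂ := by
    intro s t a b
    have hst : S t b = S s (S (t - s) b) := by
      rw [← mul_apply_eq_comp, ← hSadd, add_sub_cancel]
    rw [hst, ContinuousLinearMap.inner_map_map_of_mem_unitary (hSunitary s)]
  have hint' : ∀ m n : Fin N, Integrable fun t : ℝ =>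
      Complex.exp (-(Complex.I * t * E)) * ⟪g m, S t (g n)⟫_ℂ := by
    intro m n
    refine (hint m n).bdd_mul (c := 1) (by fun_prop) (Eventually.of_forall fun t => ?_)
    simp [Complex.norm_exp]
  refine ⟨fun m n => ?_, fun c => ?_⟩
  · rw [← integral_conj, ← integral_neg_eq_self]
    refine integral_congr_ae (Eventually.of_forall fun t => ?_)
    have h : ⟪S (-t) (g n), g m⟫_ℂ = ⟪g n, S t (g m)⟫_ℂ := by
      simpa [hS0] using hshift (-t) 0 (g n) (g m)
    simp only [map_mul, inner_conj_symm, ← Complex.exp_conj, map_neg, Complex.conj_I,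
      Complex.conj_ofReal]
    simp [h]
  · set f : H := ∑ n, c n • g n with hf
    have hexpand : ∀ t : ℝ, Complex.exp (-(Complex.I * t * E)) * ⟪f, S t f⟫_ℂ =
        ∑ m, ∑ n, (starRingEnd ℂ) (c m) * c n *
          (Complex.exp (-(Complex.I * t * E)) * ⟪g m, S t (g n)⟫_ℂ) := by
      intro t
      simp only [hf, map_sum, map_smul, sum_inner, inner_sum, inner_smul_left, inner_smul_right,
        Finset.mul_sum]
      rw [Finset.sum_comm]
      refine Finset.sum_congr rfl fun m _ => Finset.sum_congr rfl fun n _ => ?_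
      ring
    have hterm : ∀ m n : Fin N, Integrable fun t : ℝ => (starRingEnd ℂ) (c m) * c n *
        (Complex.exp (-(Complex.I * t * E)) * ⟪g m, S t (g n)⟫_ℂ) :=
      fun m n => (hint' m n).const_mul _
    have hsum : ∑ m, ∑ n, (starRingEnd ℂ) (c m) * c n *
          ∫ t : ℝ, Complex.exp (-(Complex.I * t * E)) * ⟪g m, S t (g n)⟫_ℂ =
        ∫ t : ℝ, Complex.exp (-(Complex.I * t * E)) * ⟪f, S t f⟫_ℂ := by
      simp only [hexpand]
      rw [integral_finsetSum _ fun m _ => integrable_finsetSum _ fun n _ => hterm m n]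
      refine Finset.sum_congr rfl fun m _ => ?_
      rw [integral_finsetSum _ fun n _ => hterm m n]
      simp only [integral_const_mul]
    rw [hsum]
    refine integral_nonneg_of_inner_eq_sub
      (x := fun t : ℝ => Complex.exp (-(Complex.I * t * E)) • S t f) ?_ ?_ fun s t => ?_
    · exact Continuous.smul (by fun_prop) (hScont f)
    · simp only [hexpand]
      exact integrable_finsetSum _ fun m _ => integrable_finsetSum _ fun n _ => hterm m n
    · simp only [inner_smul_left, inner_smul_right, hshift, ← Complex.exp_conj]
      rw [← mul_assoc, ← Complex.exp_add]
      congr 2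
      simp
      ring
end

section
/- Let h be an integrable complex-valued function on [0,∞), let σ be a nonzero real number, and let φ : ℝ² → ℂ be continuous with compact support. Then lim_{ξ→0⁺} (1/ξ) ∫_0^∞ dt_1 ∫_0^{t_1} dt_2 φ(t_1,t_2) e^{iσ t_2/ξ} h((t_1 − t_2)/ξ) = 0. -/
open MeasureTheory Filter
open scoped Topology

/-- The Riemann–Lebesgue lemma along the frequencies `σ / ξ` with `ξ → 0⁺`. -/
theorem tendsto_integral_exp_div_mul_nhdsGT_zero {σ : ℝ} (hσ : σ ≠ 0) (f : ℝ → ℂ) :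
    Tendsto (fun ξ : ℝ => ∫ t : ℝ, Complex.exp (Complex.I * σ * t / ξ) * f t) (𝓝[>] 0) (𝓝 0) := by
  have hlim : Tendsto (fun ξ : ℝ => (-σ / (2 * Real.pi)) * ξ⁻¹) (𝓝[>] 0) (cocompact ℝ) :=
    (tendsto_cocompact_mul_left₀ (by simp [hσ, Real.pi_ne_zero])).comp
      (tendsto_inv_nhdsGT_zero.mono_right atTop_le_cocompact)
  refine ((Real.tendsto_integral_exp_smul_cocompact f).comp hlim).congr fun ξ => ?_
  refine integral_congr_ae (Eventually.of_forall fun t => ?_)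
  simp only [Circle.smul_def, Real.fourierChar_apply, smul_eq_mul]
  congr 2
  push_cast
  have : (Real.pi : ℂ) ≠ 0 := by exact_mod_cast Real.pi_ne_zero
  field_simp

/-- The region `ξ s ≤ t` is the domain of integration in the rescaled variable
`s = (t - t₂) / ξ`. -/
theorem inv_mul_intervalIntegral_rescale (h : ℝ → ℂ) (σ : ℝ) (φ : ℝ × ℝ → ℂ) {ξ t : ℝ}
    (hξ : 0 < ξ) (ht : 0 < t) :
    (1 / ξ : ℂ) * ∫ t₂ in (0 : ℝ)..t,
        φ (t, t₂) * Complex.exp (Complex.I * σ * t₂ / ξ) * h ((t - t₂) / ξ) =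
      Complex.exp (Complex.I * σ * t / ξ) * ∫ s in Set.Ioi (0 : ℝ),
        {p : ℝ × ℝ | ξ * p.2 ≤ p.1}.indicator (fun p => φ (p.1, p.1 - ξ * p.2)) (t, s) *
          (Complex.exp (-Complex.I * σ * s) * h s) := by
  have hξ' : (ξ : ℂ) ≠ 0 := by exact_mod_cast hξ.ne'
  have hsub := intervalIntegral.integral_comp_sub_div (a := 0) (b := t)
    (fun s : ℝ => φ (t, t - ξ * s) * Complex.exp (Complex.I * σ * ((t - ξ * s : ℝ) : ℂ) / ξ) * h s)
    hξ.ne' (t / ξ)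
  have hpt : ∀ x : ℝ, t - ξ * ((t - x) / ξ) = x := fun x => by field_simp; ring
  simp only [← sub_div, hpt, sub_self, zero_div, sub_zero] at hsub
  rw [hsub, Complex.real_smul, ← mul_assoc, one_div, inv_mul_cancel₀ hξ', one_mul,
    intervalIntegral.integral_of_le (by positivity), ← integral_const_mul,
    ← integral_indicator measurableSet_Ioc, ← integral_indicator measurableSet_Ioi]
  refine integral_congr_ae (Eventually.of_forall fun s => ?_)
  have hiff : s ≤ t / ξ ↔ ξ * s ≤ t := by rw [le_div_iff₀ hξ, mul_comm]
  have hexp : Complex.exp (Complex.I * σ * ((t - ξ * s : ℝ) : ℂ) / ξ) =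
      Complex.exp (Complex.I * σ * t / ξ) * Complex.exp (-Complex.I * σ * s) := by
    rw [← Complex.exp_add]
    congr 1
    push_cast
    field_simp
    ring
  simp only [Set.indicator_apply, Set.mem_Ioc, Set.mem_Ioi, Set.mem_ofPred_eq, hiff, hexp]
  by_cases h_pos : 0 < s <;> by_cases h_le : ξ * s ≤ t <;>
    simp only [h_pos, h_le, and_true, and_false, if_true, if_false] <;> ring

/-- Integrating `φ` against a kernel that concentrates on the diagonal gives integrable functions
which converge in `L¹` to the diagonal values of `φ` times the mass of the kernel. -/
theorem tendsto_integral_norm_sub_diagonal {φ : ℝ × ℝ → ℂ} (hφ : Continuous φ)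
    (hφc : HasCompactSupport φ) {g : ℝ → ℂ} (hg : IntegrableOn g (Set.Ioi 0)) :
    (∀ ξ : ℝ, IntegrableOn (fun t => ∫ s in Set.Ioi (0 : ℝ),
        {p : ℝ × ℝ | ξ * p.2 ≤ p.1}.indicator (fun p => φ (p.1, p.1 - ξ * p.2)) (t, s) * g s)
        (Set.Ioi 0)) ∧
      Tendsto (fun ξ : ℝ => ∫ t in Set.Ioi (0 : ℝ), ‖(∫ s in Set.Ioi (0 : ℝ),
        {p : ℝ × ℝ | ξ * p.2 ≤ p.1}.indicator (fun p => φ (p.1, p.1 - ξ * p.2)) (t, s) * g s) -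
          ∫ s in Set.Ioi (0 : ℝ), φ (t, t) * g s‖) (𝓝[>] 0) (𝓝 0) := by
  obtain ⟨C, hC⟩ := hφc.exists_bound_of_continuous hφ
  set K : Set ℝ := Prod.fst '' tsupport φ
  have hK : IsCompact K := hφc.isCompact.image continuous_fst
  have hφK : ∀ t x, t ∉ K → φ (t, x) = 0 := fun t x ht =>
    image_eq_zero_of_notMem_tsupport fun hx => ht ⟨_, hx, rfl⟩
  set F : ℝ → ℝ × ℝ → ℂ := fun ξ =>
    {p : ℝ × ℝ | ξ * p.2 ≤ p.1}.indicator (fun p => φ (p.1, p.1 - ξ * p.2)) with hF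
  have hFC : ∀ ξ p, ‖F ξ p‖ ≤ C := fun ξ p => (norm_indicator_le_norm_self _ _).trans (hC _)
  have hFm : ∀ ξ, Measurable (F ξ) := fun ξ =>
    (by fun_prop : Continuous fun p : ℝ × ℝ => φ (p.1, p.1 - ξ * p.2)).measurable.indicator
      (measurableSet_le (by fun_prop) (by fun_prop))
  have hGm : ∀ ξ, AEStronglyMeasurable (fun t => ∫ s in Set.Ioi (0 : ℝ), F ξ (t, s) * g s)
      (volume.restrict (Set.Ioi 0)) := fun ξ =>
    ((hFm ξ).aestronglyMeasurable.mul
      hg.aestronglyMeasurable.comp_snd).integral_prod_right'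
  set B : ℝ → ℝ := K.indicator fun _ => C * ∫ s in Set.Ioi (0 : ℝ), ‖g s‖
  have hBi : Integrable B (volume.restrict (Set.Ioi 0)) :=
    ((integrable_indicator_iff hK.measurableSet).2
      (integrableOn_const hK.measure_lt_top.ne)).restrict
  have hbound : ∀ (t : ℝ) (f : ℝ → ℂ), (∀ s, ‖f s‖ ≤ C) → (t ∉ K → f = 0) →
      ‖∫ s in Set.Ioi (0 : ℝ), f s * g s‖ ≤ B t := fun t f hf hf0 => by
    by_cases ht : t ∈ K
    · rw [show B t = C * ∫ s in Set.Ioi (0 : ℝ), ‖g s‖ from Set.indicator_of_mem ht _,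
        ← integral_const_mul]
      refine norm_integral_le_of_norm_le (hg.norm.const_mul C) (Eventually.of_forall fun s => ?_)
      rw [norm_mul]
      exact mul_le_mul_of_nonneg_right (hf s) (norm_nonneg _)
    · simp [hf0 ht, B, ht]
  have hGB : ∀ ξ t, ‖∫ s in Set.Ioi (0 : ℝ), F ξ (t, s) * g s‖ ≤ B t := fun ξ t =>
    hbound t _ (fun s => hFC ξ _) fun ht => by
      ext s
      simp [hF, Set.indicator_apply, hφK t _ ht]
  refine ⟨fun ξ => hBi.mono' (hGm ξ) (Eventually.of_forall (hGB ξ)), ?_⟩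
  have hDm : Continuous fun t => ∫ s in Set.Ioi (0 : ℝ), φ (t, t) * g s := by
    simp only [integral_const_mul]
    fun_prop
  rw [show 𝓝 (0 : ℝ) = 𝓝 (∫ t in Set.Ioi (0 : ℝ), (0 : ℝ)) by simp]
  refine tendsto_integral_filter_of_dominated_convergence (fun t => B t + B t)
    (Eventually.of_forall fun ξ => ((hGm ξ).sub hDm.aestronglyMeasurable).norm)
    (Eventually.of_forall fun ξ => Eventually.of_forall fun t => ?_) (hBi.add hBi) ?_
  · rw [norm_norm]
    refine (norm_sub_le _ _).trans (add_le_add (hGB ξ t) (hbound t _ (fun s => hC _) fun ht => ?_))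
    ext s
    simp [hφK t _ ht]
  · filter_upwards [self_mem_ae_restrict measurableSet_Ioi] with t ht
    rw [← tendsto_iff_norm_sub_tendsto_zero]
    refine tendsto_integral_filter_of_dominated_convergence (fun s => C * ‖g s‖)
      (Eventually.of_forall fun ξ => ((hFm ξ).comp measurable_prodMk_left).aestronglyMeasurable.mul
        hg.aestronglyMeasurable)
      (Eventually.of_forall fun ξ => Eventually.of_forall fun s => ?_) (hg.norm.const_mul C)
      (Eventually.of_forall fun s => ?_)
    · rw [norm_mul]
      exact mul_le_mul_of_nonneg_right (hFC ξ _) (norm_nonneg _)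
    · refine Tendsto.mul_const _ (tendsto_nhdsWithin_of_tendsto_nhds ?_)
      have hsmall : ∀ᶠ ξ : ℝ in 𝓝 0, ξ * s < t := by
        refine (by fun_prop : Continuous fun ξ : ℝ => ξ * s).continuousAt.eventually_lt
          continuousAt_const ?_
        simpa using ht
      have hlim : Tendsto (fun ξ : ℝ => φ (t, t - ξ * s)) (𝓝 0) (𝓝 (φ (t, t))) := by
        simpa using (by fun_prop : Continuous fun ξ : ℝ => φ (t, t - ξ * s)).tendsto 0
      refine hlim.congr' ?_
      filter_upwards [hsmall] with ξ hξ
      simp [hξ.le]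

/-- The oscillatory scaling lemma of the low density limit: for `h` integrable on
`[0,∞)`, `σ ≠ 0`, and `φ` continuous with compact support,
`(1/ξ) ∫_0^∞ dt₁ ∫_0^{t₁} dt₂ φ(t₁,t₂) e^{iσt₂/ξ} h((t₁−t₂)/ξ) → 0` as `ξ → 0⁺`. -/
theorem lowDensity_oscillatory_scaling_lemma
    (h : ℝ → ℂ) (hh : IntegrableOn h (Set.Ici (0 : ℝ)))
    (σ : ℝ) (hσ : σ ≠ 0)
    (φ : ℝ × ℝ → ℂ) (hφ : Continuous φ) (hφc : HasCompactSupport φ) :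
    Tendsto
      (fun ξ : ℝ => (1 / ξ : ℂ) *
        ∫ t₁ in Set.Ioi (0 : ℝ), ∫ t₂ in (0 : ℝ)..t₁,
          φ (t₁, t₂) * Complex.exp (Complex.I * σ * t₂ / ξ) * h ((t₁ - t₂) / ξ))
      (𝓝[>] 0) (𝓝 0) := by
  have hexp : ∀ x : ℝ, ‖Complex.exp (Complex.I * σ * x)‖ = 1 := fun x => by
    simp [Complex.norm_exp]
  have hexp' : ∀ ξ t : ℝ, ‖Complex.exp (Complex.I * σ * t / ξ)‖ = 1 := fun ξ t => by
    rw [← hexp (t / ξ)]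
    push_cast
    rw [mul_div_assoc]
  set g : ℝ → ℂ := fun s => Complex.exp (-Complex.I * σ * s) * h s with hg_def
  have hg : IntegrableOn g (Set.Ioi 0) := by
    refine (hh.mono_set Set.Ioi_subset_Ici_self).bdd_mul (c := 1)
      (by fun_prop : Continuous fun s : ℝ =>
        Complex.exp (-Complex.I * σ * s)).aestronglyMeasurable
      (Eventually.of_forall fun s => ?_)
    simpa using (hexp (-s)).le
  obtain ⟨hGi, hG⟩ := tendsto_integral_norm_sub_diagonal hφ hφc hg
  set G : ℝ → ℝ → ℂ := fun ξ t => ∫ s in Set.Ioi (0 : ℝ),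
    {p : ℝ × ℝ | ξ * p.2 ≤ p.1}.indicator (fun p => φ (p.1, p.1 - ξ * p.2)) (t, s) * g s
    with hG_def
  set D : ℝ → ℂ := fun t => ∫ s in Set.Ioi (0 : ℝ), φ (t, t) * g s with hD_def
  have hDi : IntegrableOn D (Set.Ioi 0) := by
    refine (hGi 0).congr_fun (fun t ht => ?_) measurableSet_Ioi
    simp [hD_def, (Set.mem_Ioi.1 ht).le]
  have hmul : ∀ (ξ : ℝ) {f : ℝ → ℂ}, IntegrableOn f (Set.Ioi 0) →
      IntegrableOn (fun t : ℝ => Complex.exp (Complex.I * σ * t / ξ) * f t) (Set.Ioi 0) :=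
    fun ξ f hf => hf.bdd_mul (c := 1)
      (by fun_prop : Continuous fun t : ℝ =>
        Complex.exp (Complex.I * σ * t / ξ)).aestronglyMeasurable
      (Eventually.of_forall fun t => (hexp' ξ t).le)
  have hRL : Tendsto (fun ξ : ℝ => ∫ t in Set.Ioi (0 : ℝ),
      Complex.exp (Complex.I * σ * t / ξ) * D t) (𝓝[>] 0) (𝓝 0) := by
    refine (tendsto_integral_exp_div_mul_nhdsGT_zero hσ ((Set.Ioi 0).indicator D)).congr
      fun ξ => ?_
    rw [← integral_indicator measurableSet_Ioi]
    simp only [Set.indicator_mul_right]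
  have hdiff : Tendsto (fun ξ : ℝ => ∫ t in Set.Ioi (0 : ℝ),
      Complex.exp (Complex.I * σ * t / ξ) * (G ξ t - D t)) (𝓝[>] 0) (𝓝 0) := by
    refine squeeze_zero_norm (fun ξ => (norm_integral_le_integral_norm _).trans_eq ?_) hG
    simp only [norm_mul, hexp', one_mul, hG_def, hD_def]
  rw [← add_zero (0 : ℂ)]
  refine (hdiff.add hRL).congr' ?_
  filter_upwards [self_mem_nhdsWithin] with ξ hξ
  have hsub : IntegrableOn (fun t => G ξ t - D t) (Set.Ioi 0) := (hGi ξ).sub hDi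
  rw [← integral_add (hmul ξ hsub) (hmul ξ hDi), ← integral_const_mul]
  refine setIntegral_congr_fun measurableSet_Ioi fun t ht => ?_
  simp only [← mul_add, sub_add_cancel]
  exact (inv_mul_intervalIntegral_rescale h σ φ hξ ht).symm
end
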